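/- arXiv:1908.11695 — 3 statements merged into one kernel-verified Lean document; each statement's English description precedes it below -/
import Mathlib

section
/- Let Y be a metric space and X a separable metric space, and let y ↦ K_y be a map from Y into the collection of nonempty compact subsets of X. Suppose that for every sequence y_n → y in Y and every choice x_n ∈ K_{y_n}, the sequence (x_n) has a limit point belonging to K_y. Then y ↦ K_y is Borel measurable as a map from Y into the space of nonempty compact subsets of X endowed with the Hausdorff metric. -/
open TopologicalSpace Filter

/-- Stroock–Varadhan, Lemma 12.1.8: if `y ↦ K_y` maps a metric space `Y` into the
nonempty compact subsets of a separable metric space `X`, and for every sequence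
`yₙ → y` and every choice `xₙ ∈ K_{yₙ}` the sequence `(xₙ)` has a limit point in
`K_y`, then `y ↦ K_y` is Borel measurable into the space of nonempty compact
subsets of `X` with the Hausdorff metric. -/
theorem setValued_map_borel_measurable
    {Y X : Type*} [MetricSpace Y] [MetricSpace X] [SeparableSpace X]
    [MeasurableSpace Y] [BorelSpace Y]
    [MeasurableSpace (NonemptyCompacts X)] [BorelSpace (NonemptyCompacts X)]
    (K : Y → NonemptyCompacts X)
    (h : ∀ (y : ℕ → Y) (ylim : Y), Tendsto y atTop (nhds ylim) →
      ∀ x : ℕ → X, (∀ n, x n ∈ (K (y n) : Set X)) →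
        ∃ xlim ∈ (K ylim : Set X), MapClusterPt xlim atTop x) :
    Measurable K := by
  have : SecondCountableTopology X := UniformSpace.secondCountable_of_separable X
  have hclosed : ∀ F : Set X, IsClosed F →
      MeasurableSet {y | ((K y : Set X) ∩ F).Nonempty} := by
    intro F hF
    refine IsClosed.measurableSet (IsSeqClosed.isClosed ?_)
    intro y ylim hy hlim
    choose x hx using hy
    obtain ⟨z, hz, hc⟩ := h y ylim hlim x (fun n => (hx n).1)
    exact ⟨z, hz, hF.mem_of_mapClusterPt hc (Eventually.of_forall fun n => (hx n).2)⟩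
  have hgen : (NonemptyCompacts.topology : TopologicalSpace (NonemptyCompacts X)) =
      .generateFrom (Set.preimage (fun L : NonemptyCompacts X => (L : Set X)) ''
        (Set.powerset '' {U | IsOpen U} ∪
          (fun V => {s : Set X | (s ∩ V).Nonempty}) '' {V | IsOpen V})) :=
    induced_generateFrom_eq
  rw [BorelSpace.measurable_eq (α := NonemptyCompacts X),
    borel_eq_generateFrom_of_subbasis hgen]
  refine measurable_generateFrom ?_
  rintro _ ⟨_, ⟨U, hU, rfl⟩ | ⟨U, hU, rfl⟩, rfl⟩
  · have hs := (hclosed Uᶜ (IsOpen.isClosed_compl hU)).compl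
    convert hs using 1
    ext y
    simp [Set.inter_compl_nonempty_iff]
  · obtain ⟨F, hF, -, hFU, -⟩ := IsOpen.exists_iUnion_isClosed hU
    convert MeasurableSet.iUnion (fun n => hclosed (F n) (hF n)) using 1
    ext y
    simp only [Set.mem_preimage, Set.mem_setOf_eq, Set.mem_iUnion]
    rw [← Set.nonempty_iUnion, ← Set.inter_iUnion]
    simp_all
end

section
/- Let H be a metric space and let Q be the set of continuous functions q : [0,∞) → H. Let D ⊆ H and let U assign to each x ∈ D a set U(x) ⊆ Q such that: (compatibility) q(0) = x and q(t) ∈ D for all q ∈ U(x) and t ≥ 0; (shift invariance) for every x ∈ D, q ∈ U(x) and T ≥ 0, the shifted trajectory S_T ∘ q belongs to U(q(T)); (continuation) for every x ∈ D, q₁ ∈ U(x), T ≥ 0 and q₂ ∈ U(q₁(T)), the glued trajectory q₁ ∪_T q₂ belongs to U(x). Let λ > 0 and let F : H → ℝ be bounded and continuous, and set I(q) = ∫₀^∞ e^{-λt} F(q(t)) dt. If x ∈ D and q ∈ U(x) satisfies I(q) ≤ I(q̃) for all q̃ ∈ U(x), then for every T ≥ 0 the shifted trajectory S_T ∘ q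 satisfies I(S_T ∘ q) ≤ I(q') for all q' ∈ U(q(T)). -/
open Set Filter MeasureTheory

/-- The time shift operator: `(S_T ∘ q)(t) = q(T + t)`. -/
def shiftTraj {H : Type*} (T : ℝ) (q : ℝ → H) : ℝ → H := fun t => q (T + t)

/-- The continuation operator: `(q₁ ∪_T q₂)(t) = q₁(t)` for `0 ≤ t ≤ T` and
`(q₁ ∪_T q₂)(t) = q₂(t − T)` for `t > T`. -/
noncomputable def glueTraj {H : Type*} (T : ℝ) (q₁ q₂ : ℝ → H) : ℝ → H :=
  fun t => if t ≤ T then q₁ t else q₂ (t - T)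

/-- The functional `I_{λ,F}(q) = ∫₀^∞ e^{-λt} F(q(t)) dt`. -/
noncomputable def Ifun {H : Type*} (lam : ℝ) (F : H → ℝ) (q : ℝ → H) : ℝ :=
  ∫ t in Ioi (0 : ℝ), Real.exp (-lam * t) * F (q t)

theorem Ifun_integrableOn {H : Type*} [MetricSpace H] (lam : ℝ) (hlam : 0 < lam)
    (F : H → ℝ) (hFc : Continuous F) (hFb : ∃ C, ∀ y, |F y| ≤ C)
    (p : ℝ → H) (hp : ContinuousOn p (Ici 0)) :
    IntegrableOn (fun t => Real.exp (-lam * t) * F (p t)) (Ioi 0) := by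
  obtain ⟨C, hC⟩ := hFb
  have h1 : IntegrableOn (fun t : ℝ => Real.exp (-lam * t)) (Ioi 0) :=
    integrableOn_exp_mul_Ioi (by linarith) 0
  refine Integrable.mul_bdd (c := C) h1 ?_ ?_
  · exact ((hFc.comp_continuousOn hp).mono Ioi_subset_Ici_self).aestronglyMeasurable
      measurableSet_Ioi
  · exact Eventually.of_forall fun t => hC _

theorem Ifun_split {H : Type*} [MetricSpace H] (lam : ℝ) (hlam : 0 < lam)
    (F : H → ℝ) (hFc : Continuous F) (hFb : ∃ C, ∀ y, |F y| ≤ C)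
    (p : ℝ → H) (hp : ContinuousOn p (Ici 0)) (T : ℝ) (hT : 0 ≤ T) :
    Ifun lam F p = (∫ t in Ioc 0 T, Real.exp (-lam * t) * F (p t))
      + Real.exp (-lam * T) * Ifun lam F (shiftTraj T p) := by
  have hi := Ifun_integrableOn lam hlam F hFc hFb p hp
  have h2 : Real.exp (-lam * T) * Ifun lam F (shiftTraj T p)
      = ∫ t in Ioi T, Real.exp (-lam * t) * F (p t) := by
    have h3 := (measurePreserving_add_left (volume : Measure ℝ) T).setIntegral_preimage_emb
      (measurableEmbedding_addLeft T) (fun t => Real.exp (-lam * t) * F (p t)) (Ioi T)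
    rw [preimage_const_add_Ioi, sub_self] at h3
    rw [← h3, Ifun, ← integral_const_mul]
    congr 1
    ext t
    rw [shiftTraj, mul_add, Real.exp_add, mul_assoc]
  rw [h2, Ifun, ← Ioc_union_Ioi_eq_Ioi hT]
  exact setIntegral_union (Ioc_disjoint_Ioi le_rfl) measurableSet_Ioi
    (hi.mono_set Ioc_subset_Ioi_self) (hi.mono_set (Ioi_subset_Ioi hT))

/-- (P4), abstract form: a minimizer of `I_{λ,F}` over `U(x)` remains, after a
time shift by `T ≥ 0`, a minimizer of `I_{λ,F}` over `U(q(T))`. -/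
theorem shift_of_minimizer_is_minimizer
    {H : Type*} [MetricSpace H] (D : Set H) (U : H → Set (ℝ → H))
    (hQ : ∀ x ∈ D, ∀ q ∈ U x, ContinuousOn q (Ici 0))
    (hcompat : ∀ x ∈ D, ∀ q ∈ U x, q 0 = x ∧ ∀ t ≥ (0 : ℝ), q t ∈ D)
    (hshift : ∀ x ∈ D, ∀ q ∈ U x, ∀ T ≥ (0 : ℝ), shiftTraj T q ∈ U (q T))
    (hglue : ∀ x ∈ D, ∀ q₁ ∈ U x, ∀ T ≥ (0 : ℝ), ∀ q₂ ∈ U (q₁ T),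
      glueTraj T q₁ q₂ ∈ U x)
    (lam : ℝ) (hlam : 0 < lam)
    (F : H → ℝ) (hFc : Continuous F) (hFb : ∃ C, ∀ y, |F y| ≤ C)
    (x : H) (hx : x ∈ D) (q : ℝ → H) (hq : q ∈ U x)
    (hmin : ∀ q' ∈ U x, Ifun lam F q ≤ Ifun lam F q')
    (T : ℝ) (hT : 0 ≤ T) :
    ∀ q' ∈ U (q T), Ifun lam F (shiftTraj T q) ≤ Ifun lam F q' := by
  intro q' hq'
  have hg := hglue x hx q hq T hT q' hq'
  have h := hmin _ hg
  rw [Ifun_split lam hlam F hFc hFb q (hQ x hx q hq) T hT,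
    Ifun_split lam hlam F hFc hFb _ (hQ x hx _ hg) T hT] at h
  have e1 : (∫ t in Ioc 0 T, Real.exp (-lam * t) * F (glueTraj T q q' t))
      = ∫ t in Ioc 0 T, Real.exp (-lam * t) * F (q t) := by
    refine setIntegral_congr_fun measurableSet_Ioc fun t ht => ?_
    simp only [glueTraj, if_pos ht.2]
  have e2 : Ifun lam F (shiftTraj T (glueTraj T q q')) = Ifun lam F q' := by
    refine setIntegral_congr_fun measurableSet_Ioi fun t ht => ?_
    have ht' : ¬ (T + t ≤ T) := by
      have := mem_Ioi.1 ht
      linarith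
    simp only [shiftTraj, glueTraj, if_neg ht', add_sub_cancel_left]
  rw [e1, e2] at h
  exact le_of_mul_le_mul_left (by linarith) (Real.exp_pos (-lam * T))
end

section
/- Let H be a separable Hilbert space and let Q be the space of continuous functions q : [0,∞) → H with the topology of locally uniform convergence. Let D ⊆ H be a Borel set and let U assign to each x ∈ D a nonempty compact subset U(x) ⊆ Q such that: (measurability) x ↦ U(x) is Borel measurable from D into the space of nonempty compact subsets of Q with the Hausdorff metric; (compatibility) q(0) = x and q(t) ∈ D for all q ∈ U(x) and t ≥ 0; (shift invariance) for every x ∈ D, q ∈ U(x) and T ≥ 0, the shifted trajectory S_T ∘ q belongs to U(q(T)); (continuation) for every x ∈ D, q₁ ∈ U(x), T ≥ 0 and q₂ ∈ U(q₁(T)), the glued trajectory q₁ ∪_T q₂ belongs to U(x). Then there exists a Borel measurable map u : D → Q such that u(x) ∈ U(x) for every x ∈ D and the semigroup property holds: for all x ∈ D and all t₁, t₂ ≥ 0, u(x)(t₁ + t₂) = u( u(x)(t₁) )(t₂). -/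
open Set Filter MeasureTheory TopologicalSpace
open scoped NNReal

/-- The time shift operator on continuous trajectories: `(S_T ∘ q)(t) = q(T + t)`. -/
noncomputable def shiftCM {H : Type*} [TopologicalSpace H] (T : ℝ≥0) (q : C(ℝ≥0, H)) :
    C(ℝ≥0, H) :=
  q.comp ⟨fun t => T + t, by continuity⟩

/-- Uniqueness of the Laplace transform at positive integers. -/
theorem laplace_zero (f : ℝ → ℝ) (hf : Continuous f) (hb : ∀ t, |f t| ≤ 1)
    (h : ∀ m : ℕ, ∫ t in Ioi (0:ℝ), Real.exp (-((m:ℝ)+1) * t) * f t = 0) :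
    ∀ t ∈ Ioi (0:ℝ), f t = 0 := by
  have hint : ∀ m : ℕ, IntegrableOn (fun t => Real.exp (-((m:ℝ)+1) * t) * f t) (Ioi 0) := by
    intro m
    refine Integrable.mul_bdd (c := 1) (exp_neg_integrableOn_Ioi 0 (by positivity)) hf.aestronglyMeasurable ?_
    exact Eventually.of_forall fun t => by simpa using hb t
  have hpoly : ∀ p : Polynomial ℝ,
      IntegrableOn (fun t => Real.exp (-t) * f t * p.eval (Real.exp (-t))) (Ioi 0) ∧
      ∫ t in Ioi (0:ℝ), Real.exp (-t) * f t * p.eval (Real.exp (-t)) = 0 := by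
    intro p
    induction p using Polynomial.induction_on' with
    | add p q hp hq =>
      simp only [Polynomial.eval_add, mul_add]
      refine ⟨hp.1.add hq.1, ?_⟩
      rw [integral_add hp.1 hq.1, hp.2, hq.2, add_zero]
    | monomial n a =>
      have e : (fun t => Real.exp (-t) * f t * (Polynomial.monomial n a).eval (Real.exp (-t)))
          = fun t => a * (Real.exp (-((n:ℝ)+1) * t) * f t) := by
        funext t
        have : Real.exp (-((n:ℝ)+1) * t) = Real.exp (-t) * Real.exp (-t) ^ n := by
          rw [← Real.exp_nat_mul, ← Real.exp_add]; congr 1; ring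
        rw [Polynomial.eval_monomial, this]; ring
      rw [e]
      refine ⟨(hint n).const_mul a, ?_⟩
      rw [integral_const_mul, h n, mul_zero]
  have hg : Continuous fun s : ℝ => s * f (-Real.log s) := by
    rw [continuous_iff_continuousAt]
    intro s
    by_cases hs : s = 0
    · subst hs
      have : Tendsto (fun s : ℝ => s * f (-Real.log s)) (nhds 0) (nhds 0) := by
        refine squeeze_zero_norm (a := fun s => |s|) (fun s => ?_) ?_
        · rw [norm_mul, Real.norm_eq_abs, Real.norm_eq_abs]
          exact mul_le_of_le_one_right (abs_nonneg _) (hb _)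
        · simpa using (continuous_abs.tendsto (0:ℝ))
      simpa [ContinuousAt] using this
    · exact continuousAt_id.mul (hf.continuousAt.comp (Real.continuousAt_log hs).neg)
  have hI1 : IntegrableOn (fun t:ℝ => Real.exp (-t)) (Ioi 0) := by
    simpa using exp_neg_integrableOn_Ioi 0 (b := 1) one_pos
  have hint2 : IntegrableOn (fun t => (Real.exp (-t) * f t) * (Real.exp (-t) * f t)) (Ioi 0) := by
    have h0 : IntegrableOn (fun t => Real.exp (-t) * f t) (Ioi 0) := by simpa using hint 0
    refine Integrable.mul_bdd (c := 1) h0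
      (by fun_prop) ?_
    refine (ae_restrict_mem measurableSet_Ioi).mono fun t ht => ?_
    rw [norm_mul, Real.norm_eq_abs, Real.norm_eq_abs, Real.abs_exp]
    exact mul_le_one₀ (by simpa using le_of_lt ht) (abs_nonneg _) (hb t)
  have hz : ∫ t in Ioi (0:ℝ), (Real.exp (-t) * f t) * (Real.exp (-t) * f t) = 0 := by
    refine le_antisymm (le_of_forall_pos_le_add fun ε hε => ?_)
      (integral_nonneg fun t => mul_self_nonneg _)
    obtain ⟨p, hp⟩ := exists_polynomial_near_of_continuousOn 0 1 _ hg.continuousOn ε hε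
    have e1 : ∫ t in Ioi (0:ℝ), (Real.exp (-t) * f t) * (Real.exp (-t) * f t)
        = ∫ t in Ioi (0:ℝ), ((Real.exp (-t) * f t) * (Real.exp (-t) * f t)
          - Real.exp (-t) * f t * p.eval (Real.exp (-t))) := by
      rw [integral_sub hint2 (hpoly p).1, (hpoly p).2, sub_zero]
    rw [e1, zero_add]
    calc _ ≤ ∫ t in Ioi (0:ℝ), ε * Real.exp (-t) := by
          refine setIntegral_mono_on (hint2.sub (hpoly p).1) (hI1.const_mul ε) measurableSet_Ioi
            fun t ht => ?_
          have := hp (Real.exp (-t)) ⟨(Real.exp_pos _).le, by simpa using le_of_lt ht⟩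
          simp only [Real.log_exp, neg_neg] at this
          have h2 : |Real.exp (-t) * f t * (Real.exp (-t) * f t - p.eval (Real.exp (-t)))|
              ≤ Real.exp (-t) * ε := by
            rw [abs_mul, abs_sub_comm]
            refine mul_le_mul ?_ this.le (abs_nonneg _) (Real.exp_pos _).le
            rw [abs_mul, Real.abs_exp]
            exact mul_le_of_le_one_right (Real.exp_pos _).le (hb t)
          have h3 := le_of_abs_le h2
          linarith
      _ = ε := by rw [integral_const_mul, integral_exp_neg_Ioi_zero, mul_one]
  have hae := (setIntegral_eq_zero_iff_of_nonneg_ae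
    (Eventually.of_forall fun t => mul_self_nonneg _) hint2).1 hz
  have heq := Measure.eqOn_open_of_ae_eq hae isOpen_Ioi (by fun_prop) (by fun_prop)
  intro t ht
  have := heq ht
  simpa [Real.exp_ne_zero] using this

/-- The discounted cost functional. -/
noncomputable def costJ {H : Type*} [TopologicalSpace H] (m : ℕ) (φ : H → ℝ) (q : C(ℝ≥0, H)) : ℝ :=
  ∫ t in Ioi (0:ℝ), Real.exp (-((m:ℝ)+1) * t) * φ (q t.toNNReal)

theorem costJ_integrable {H : Type*} [TopologicalSpace H] (m : ℕ) (φ : H → ℝ) (hφ : Continuous φ)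
    (hb : ∀ x, |φ x| ≤ 1) (q : C(ℝ≥0, H)) :
    IntegrableOn (fun t => Real.exp (-((m:ℝ)+1) * t) * φ (q t.toNNReal)) (Ioi 0) := by
  refine Integrable.mul_bdd (c := 1) (exp_neg_integrableOn_Ioi 0 (by positivity))
    (Continuous.aestronglyMeasurable (by fun_prop)) ?_
  exact Eventually.of_forall fun t => by simpa using hb _

theorem costJ_continuous {H : Type*} [NormedAddCommGroup H] (m : ℕ) (φ : H → ℝ)
    (hφ : Continuous φ) (hb : ∀ x, |φ x| ≤ 1) :
    Continuous (costJ m φ : C(ℝ≥0, H) → ℝ) := by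
  unfold costJ
  refine continuous_of_dominated (bound := fun t => Real.exp (-((m:ℝ)+1) * t))
    (fun q => (costJ_integrable m φ hφ hb q).aestronglyMeasurable) (fun q => ?_)
    (exp_neg_integrableOn_Ioi 0 (by positivity)) ?_
  · refine Eventually.of_forall fun t => ?_
    rw [norm_mul, Real.norm_eq_abs, Real.norm_eq_abs, Real.abs_exp]
    exact mul_le_of_le_one_right (Real.exp_pos _).le (hb _)
  · refine Eventually.of_forall fun t => ?_
    exact continuous_const.mul (hφ.comp (continuous_eval_const t.toNNReal))

theorem costJ_split {H : Type*} [TopologicalSpace H] (m : ℕ) (φ : H → ℝ) (hφ : Continuous φ)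
    (hb : ∀ x, |φ x| ≤ 1) (q : C(ℝ≥0, H)) (T : ℝ≥0) :
    costJ m φ q = (∫ t in Ioc (0:ℝ) T, Real.exp (-((m:ℝ)+1) * t) * φ (q t.toNNReal))
      + Real.exp (-((m:ℝ)+1) * T) * costJ m φ (shiftCM T q) := by
  have hI := costJ_integrable m φ hφ hb q
  have hu : Ioc (0:ℝ) T ∪ Ioi (T:ℝ) = Ioi 0 := Ioc_union_Ioi_eq_Ioi T.coe_nonneg
  unfold costJ
  rw [← hu, setIntegral_union Ioc_disjoint_Ioi_same measurableSet_Ioi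
    (hI.mono_set Ioc_subset_Ioi_self) (hI.mono_set (Ioi_subset_Ioi T.coe_nonneg)), hu]
  congr 1
  rw [← (measurePreserving_add_left volume (T:ℝ)).setIntegral_preimage_emb
    (measurableEmbedding_addLeft _), ← integral_const_mul]
  have hp : (fun x : ℝ => (T:ℝ) + x) ⁻¹' Ioi (T:ℝ) = Ioi 0 := by ext x; simp
  rw [hp]
  refine setIntegral_congr_fun measurableSet_Ioi fun t ht => ?_
  have h1 : ((T:ℝ) + t).toNNReal = T + t.toNNReal := by
    rw [Real.toNNReal_add T.coe_nonneg (le_of_lt ht), Real.toNNReal_coe]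
  simp only [h1, shiftCM, ContinuousMap.comp_apply, ContinuousMap.coe_mk]
  rw [← mul_assoc, ← Real.exp_add]
  congr 2
  ring

theorem costJ_glue {H : Type*} [TopologicalSpace H] (m : ℕ) (φ : H → ℝ) (hφ : Continuous φ)
    (hb : ∀ x, |φ x| ≤ 1) (q q₁ q₂ : C(ℝ≥0, H)) (T : ℝ≥0) (h0 : q₂ 0 = q₁ T)
    (h1 : ∀ t ≤ T, q t = q₁ t) (h2 : ∀ t > T, q t = q₂ (t - T)) :
    costJ m φ q = (∫ t in Ioc (0:ℝ) T, Real.exp (-((m:ℝ)+1) * t) * φ (q₁ t.toNNReal))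
      + Real.exp (-((m:ℝ)+1) * T) * costJ m φ q₂ := by
  have hs : shiftCM T q = q₂ := by
    ext t
    simp only [shiftCM, ContinuousMap.comp_apply, ContinuousMap.coe_mk]
    rcases eq_or_lt_of_le (zero_le : 0 ≤ t) with rfl | ht
    · rw [add_zero, h1 T le_rfl, h0]
    · rw [h2 _ (lt_add_of_pos_right T ht), add_tsub_cancel_left]
  rw [costJ_split m φ hφ hb q T, hs]
  congr 1
  refine setIntegral_congr_fun measurableSet_Ioc fun t ht => ?_
  rw [h1 _ (Real.toNNReal_le_iff_le_coe.2 ht.2)]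

/-- The properties of a set-valued map preserved by the minimization step. -/
structure GoodSel {H : Type*} [NormedAddCommGroup H] [MeasurableSpace H]
    (D : Set H) (V : H → Set C(ℝ≥0, H)) : Prop where
  ne : ∀ x ∈ D, (V x).Nonempty
  cpt : ∀ x ∈ D, IsCompact (V x)
  meas : ∀ C : Set C(ℝ≥0, H), IsClosed C → MeasurableSet {x : D | (V x ∩ C).Nonempty}
  compat : ∀ x ∈ D, ∀ q ∈ V x, q 0 = x ∧ ∀ t : ℝ≥0, q t ∈ D
  shift : ∀ x ∈ D, ∀ q ∈ V x, ∀ T : ℝ≥0, shiftCM T q ∈ V (q T)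
  glue : ∀ x ∈ D, ∀ q₁ ∈ V x, ∀ T : ℝ≥0, ∀ q₂ ∈ V (q₁ T),
      ∃ q ∈ V x, (∀ t ≤ T, q t = q₁ t) ∧ ∀ t > T, q t = q₂ (t - T)

/-- The set of minimizers of `J` over `V x`. -/
def argminSel {H Q : Type*} (J : Q → ℝ) (V : H → Set Q) (x : H) : Set Q :=
  {q | q ∈ V x ∧ ∀ q' ∈ V x, J q ≤ J q'}

theorem GoodSel.argmin {H : Type*} [NormedAddCommGroup H] [MeasurableSpace H]
    {D : Set H} {V : H → Set C(ℝ≥0, H)} (hV : GoodSel D V)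
    (m : ℕ) (φ : H → ℝ) (hφ : Continuous φ) (hb : ∀ x, |φ x| ≤ 1) :
    GoodSel D (argminSel (costJ m φ) V) := by
  have hJ : Continuous (costJ m φ : C(ℝ≥0, H) → ℝ) := costJ_continuous m φ hφ hb
  have hmin : ∀ x ∈ D, ∃ q ∈ V x, ∀ q' ∈ V x, costJ m φ q ≤ costJ m φ q' := by
    intro x hx
    obtain ⟨q, hq, h⟩ := (hV.cpt x hx).exists_isMinOn (hV.ne x hx) hJ.continuousOn
    exact ⟨q, hq, fun q' hq' => h hq'⟩
  refine ⟨?_, ?_, ?_, ?_, ?_, ?_⟩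
  · intro x hx
    obtain ⟨q, hq, h⟩ := hmin x hx
    exact ⟨q, hq, h⟩
  · intro x hx
    have : argminSel (costJ m φ) V x
        = V x ∩ ⋂ q' ∈ V x, {q | costJ m φ q ≤ costJ m φ q'} := by
      ext q; simp [argminSel]
    rw [this]
    exact (hV.cpt x hx).inter_right
      (isClosed_biInter fun q' _ => isClosed_le hJ continuous_const)
  · intro C hC
    have : {x : D | (argminSel (costJ m φ) V x ∩ C).Nonempty}
        = ⋂ r : ℚ, ({x : D | (V x ∩ {q | costJ m φ q ≤ r}).Nonempty}ᶜ ∪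
            {x : D | (V x ∩ (C ∩ {q | costJ m φ q ≤ r})).Nonempty}) := by
      ext ⟨x, hx⟩
      simp only [mem_ofPred_eq, mem_iInter, mem_union, mem_compl_iff]
      constructor
      · rintro ⟨q, ⟨hq, hqm⟩, hqC⟩ r
        by_cases h : (V x ∩ {q | costJ m φ q ≤ r}).Nonempty
        · right
          obtain ⟨q', hq', hr⟩ := h
          exact ⟨q, hq, hqC, (hqm q' hq').trans hr⟩
        · exact Or.inl h
      · intro h
        obtain ⟨p, hp, hpm⟩ := hmin x hx
        have key : ∀ r : ℚ, costJ m φ p ≤ r → (V x ∩ (C ∩ {q | costJ m φ q ≤ r})).Nonempty :=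
          fun r hr => (h r).resolve_left fun hn => hn ⟨p, hp, hr⟩
        have hne : (V x ∩ C).Nonempty := by
          obtain ⟨r, hr⟩ := exists_rat_gt (costJ m φ p)
          obtain ⟨q, hq, hqC, _⟩ := key r hr.le
          exact ⟨q, hq, hqC⟩
        obtain ⟨q, hq, hqm⟩ := ((hV.cpt x hx).inter_right hC).exists_isMinOn hne hJ.continuousOn
        refine ⟨q, ⟨hq.1, fun q' hq' => le_trans ?_ (hpm q' hq')⟩, hq.2⟩
        by_contra hlt
        obtain ⟨r, hr1, hr2⟩ := exists_rat_btwn (not_le.1 hlt)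
        obtain ⟨s, hs, hsC, hsr⟩ := key r hr1.le
        have h1 : costJ m φ q ≤ costJ m φ s := hqm ⟨hs, hsC⟩
        have h2 : costJ m φ s ≤ r := hsr
        linarith
    rw [this]
    refine MeasurableSet.iInter fun r => ?_
    have hcl : IsClosed {q : C(ℝ≥0, H) | costJ m φ q ≤ r} := isClosed_le hJ continuous_const
    exact (hV.meas _ hcl).compl.union (hV.meas _ (hC.inter hcl))
  · intro x hx q hq
    exact hV.compat x hx q hq.1
  · intro x hx q hq T
    refine ⟨hV.shift x hx q hq.1 T, fun q' hq' => ?_⟩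
    obtain ⟨w, hw, hw1, hw2⟩ := hV.glue x hx q hq.1 T q' hq'
    have h0 := (hV.compat _ ((hV.compat x hx q hq.1).2 T) q' hq').1
    have hle := hq.2 w hw
    rw [costJ_glue m φ hφ hb w q q' T h0 hw1 hw2, costJ_split m φ hφ hb q T] at hle
    exact le_of_mul_le_mul_left (le_of_add_le_add_left hle) (Real.exp_pos _)
  · intro x hx q₁ hq₁ T q₂ hq₂
    obtain ⟨w, hw, hw1, hw2⟩ := hV.glue x hx q₁ hq₁.1 T q₂ hq₂.1
    refine ⟨w, ⟨hw, fun q' hq' => le_trans ?_ (hq₁.2 q' hq')⟩, hw1, hw2⟩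
    have h0 := (hV.compat _ ((hV.compat x hx q₁ hq₁.1).2 T) q₂ hq₂.1).1
    rw [costJ_glue m φ hφ hb w q₁ q₂ T h0 hw1 hw2, costJ_split m φ hφ hb q₁ T]
    have := hq₂.2 _ (hV.shift x hx q₁ hq₁.1 T)
    gcongr

/-- The iterated minimization. -/
noncomputable def iterSel {H : Type*} [NormedAddCommGroup H] (φ : ℕ → H → ℝ)
    (U : H → Set C(ℝ≥0, H)) : ℕ → H → Set C(ℝ≥0, H)
  | 0 => U
  | k + 1 => argminSel (costJ k.unpair.1 (φ k.unpair.2)) (iterSel φ U k)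

theorem eq_of_costJ_eq {H : Type*} [NormedAddCommGroup H] (φ : ℕ → H → ℝ)
    (hφ : ∀ n, Continuous (φ n)) (hb : ∀ n x, 0 ≤ φ n x ∧ φ n x ≤ 1)
    (hsep : ∀ x y, (∀ n, φ n x = φ n y) → x = y) (q q' : C(ℝ≥0, H))
    (h : ∀ m n, costJ m (φ n) q = costJ m (φ n) q') : q = q' := by
  have hb' : ∀ n x, |φ n x| ≤ 1 := fun n x => abs_le.2 ⟨by linarith [(hb n x).1], (hb n x).2⟩
  have hpos : ∀ t ∈ Ioi (0:ℝ≥0), q t = q' t := by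
    intro t ht
    refine hsep _ _ fun n => ?_
    have := laplace_zero (fun t => φ n (q t.toNNReal) - φ n (q' t.toNNReal))
      (by have := hφ n; fun_prop)
      (fun t => abs_le.2 ⟨by linarith [(hb n (q t.toNNReal)).1, (hb n (q' t.toNNReal)).2],
        by linarith [(hb n (q t.toNNReal)).2, (hb n (q' t.toNNReal)).1]⟩)
      (fun m => by
        simp only [mul_sub]
        rw [integral_sub (costJ_integrable m _ (hφ n) (hb' n) q)
          (costJ_integrable m _ (hφ n) (hb' n) q')]
        exact sub_eq_zero.2 (h m n))
      (t:ℝ) (by simpa using ht)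
    simpa [sub_eq_zero] using this
  have hd : Dense (Ioi (0:ℝ≥0)) := by
    rw [dense_iff_closure_eq, closure_Ioi]
    exact Set.eq_univ_of_forall fun t => (zero_le : 0 ≤ t)
  exact ContinuousMap.coe_injective (Continuous.ext_on hd q.continuous q'.continuous hpos)

/-- Abstract semiflow selection principle (Cardona–Kapitanski): if `U` assigns to
every `x` in a Borel set `D` of a separable Hilbert space `H` a nonempty compact
set of continuous trajectories `U(x) ⊆ C([0,∞), H)` (locally uniform topology),
Borel measurably for the Hausdorff metric, such that trajectories start at `x`,
stay in `D`, and `U` is shift invariant and stable under continuation, then there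
is a Borel measurable selection `u` with `u(x) ∈ U(x)` satisfying the semigroup
property `u(x)(t₁+t₂) = u(u(x)(t₁))(t₂)`. -/
theorem semiflow_selection_exists
    {H : Type*} [NormedAddCommGroup H] [InnerProductSpace ℝ H] [CompleteSpace H]
    [SecondCountableTopology H] [MeasurableSpace H] [BorelSpace H]
    [MeasurableSpace C(ℝ≥0, H)] [BorelSpace C(ℝ≥0, H)]
    (D : Set H) (hD : MeasurableSet D)
    (U : H → Set C(ℝ≥0, H))
    (hne : ∀ x ∈ D, (U x).Nonempty)
    (hcpt : ∀ x ∈ D, IsCompact (U x))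
    (hmeas :
      letI : MetricSpace C(ℝ≥0, H) := metrizableSpaceMetric _
      letI : MeasurableSpace (NonemptyCompacts C(ℝ≥0, H)) := borel _
      Measurable fun x : D =>
        (⟨⟨U x, hcpt x x.2⟩, hne x x.2⟩ : NonemptyCompacts C(ℝ≥0, H)))
    (hcompat : ∀ x ∈ D, ∀ q ∈ U x, q 0 = x ∧ ∀ t : ℝ≥0, q t ∈ D)
    (hshift : ∀ x ∈ D, ∀ q ∈ U x, ∀ T : ℝ≥0, shiftCM T q ∈ U (q T))
    (hglue : ∀ x ∈ D, ∀ q₁ ∈ U x, ∀ T : ℝ≥0, ∀ q₂ ∈ U (q₁ T),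
      ∃ q ∈ U x, (∀ t ≤ T, q t = q₁ t) ∧ ∀ t > T, q t = q₂ (t - T)) :
    ∃ u : H → C(ℝ≥0, H),
      Measurable (fun x : D => u x) ∧
      ∀ x ∈ D, u x ∈ U x ∧
        ∀ t₁ t₂ : ℝ≥0, u x (t₁ + t₂) = u (u x t₁) t₂ := by
  have hU : GoodSel D U := by
    refine ⟨hne, hcpt, ?_, hcompat, hshift, hglue⟩
    intro C hC
    letI : MetricSpace C(ℝ≥0, H) := metrizableSpaceMetric _
    letI : MeasurableSpace (NonemptyCompacts C(ℝ≥0, H)) := borel _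
    haveI : BorelSpace (NonemptyCompacts C(ℝ≥0, H)) := ⟨rfl⟩
    exact hmeas (NonemptyCompacts.isClosed_inter_nonempty_of_isClosed hC).measurableSet
  let φ : ℕ → H → ℝ := fun n x => min 1 (dist x (denseSeq H n))
  have hφ : ∀ n, Continuous (φ n) := fun n => by
    exact continuous_const.min (continuous_id.dist continuous_const)
  have hb : ∀ n x, 0 ≤ φ n x ∧ φ n x ≤ 1 :=
    fun n x => ⟨le_min zero_le_one dist_nonneg, min_le_left _ _⟩
  have hb' : ∀ n x, |φ n x| ≤ 1 := fun n x => abs_le.2 ⟨by linarith [(hb n x).1], (hb n x).2⟩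
  have hsep : ∀ x y, (∀ n, φ n x = φ n y) → x = y := by
    intro x y h
    refine eq_of_forall_dist_le fun ε hε => ?_
    obtain ⟨z, hz, ⟨n, rfl⟩⟩ := Metric.dense_iff.1 (denseRange_denseSeq H) x
      (min 1 (ε / 2)) (lt_min one_pos (half_pos hε))
    rw [Metric.mem_ball, dist_comm, lt_min_iff] at hz
    have h1 := h n
    simp only [φ] at h1
    rw [min_eq_right hz.1.le] at h1
    have h2 : dist y (denseSeq H n) = dist x (denseSeq H n) := by
      rcases min_choice 1 (dist y (denseSeq H n)) with h3 | h3
      · rw [h3] at h1; linarith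
      · rw [h3] at h1; exact h1.symm
    have h3 := dist_triangle_right x y (denseSeq H n)
    linarith [hz.2]
  have hgood : ∀ k, GoodSel D (iterSel φ U k) := by
    intro k
    induction k with
    | zero => exact hU
    | succ k ih => exact ih.argmin _ _ (hφ _) (hb' _)
  have hanti : ∀ k x, iterSel φ U (k + 1) x ⊆ iterSel φ U k x := fun k x q hq => hq.1
  have huniq : ∀ x, ∀ q q', (∀ k, q ∈ iterSel φ U k x) → (∀ k, q' ∈ iterSel φ U k x) → q = q' := by
    intro x q q' hq hq'
    refine eq_of_costJ_eq φ hφ hb hsep q q' fun m n => ?_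
    have h1 := hq (Nat.pair m n + 1)
    have h2 := hq' (Nat.pair m n + 1)
    simp only [iterSel, argminSel, Nat.unpair_pair] at h1 h2
    exact le_antisymm (h1.2 _ h2.1) (h2.2 _ h1.1)
  have hinter : ∀ C : Set C(ℝ≥0, H), IsClosed C → ∀ x ∈ D,
      (∀ k, (iterSel φ U k x ∩ C).Nonempty) → ∃ q ∈ C, ∀ k, q ∈ iterSel φ U k x := by
    intro C hC x hx h
    have hc : ∀ k, IsCompact (iterSel φ U k x ∩ C) := fun k => ((hgood k).cpt x hx).inter_right hC
    obtain ⟨q, hq⟩ := IsCompact.nonempty_iInter_of_sequence_nonempty_isCompact_isClosed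
      (fun k => iterSel φ U k x ∩ C) (fun k => inter_subset_inter_left _ (hanti k x)) h (hc 0)
      (fun k => (hc k).isClosed)
    rw [mem_iInter] at hq
    exact ⟨q, (hq 0).2, fun k => (hq k).1⟩
  have hex : ∀ x : H, ∃ q : C(ℝ≥0, H), x ∈ D → ∀ k, q ∈ iterSel φ U k x := by
    intro x
    by_cases hx : x ∈ D
    · obtain ⟨q, -, hq⟩ := hinter univ isClosed_univ x hx
        fun k => by simpa using (hgood k).ne x hx
      exact ⟨q, fun _ => hq⟩
    · exact ⟨ContinuousMap.const _ 0, fun h => absurd h hx⟩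
  choose u hu using hex
  refine ⟨u, ?_, fun x hx => ⟨hu x hx 0, fun t₁ t₂ => ?_⟩⟩
  · refine measurable_of_isClosed fun C hC => ?_
    have : (fun x : D => u x) ⁻¹' C = ⋂ k, {x : D | (iterSel φ U k x ∩ C).Nonempty} := by
      ext ⟨x, hx⟩
      simp only [mem_preimage, mem_iInter, mem_ofPred_eq]
      constructor
      · exact fun h k => ⟨u x, hu x hx k, h⟩
      · intro h
        obtain ⟨q, hqC, hq⟩ := hinter C hC x hx h
        rwa [huniq x (u x) q (hu x hx) hq]
    rw [this]
    exact MeasurableSet.iInter fun k => (hgood k).meas C hC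
  · have hD1 : u x t₁ ∈ D := (hcompat x hx _ (hu x hx 0)).2 t₁
    have := huniq (u x t₁) (shiftCM t₁ (u x)) (u (u x t₁))
      (fun k => (hgood k).shift x hx _ (hu x hx k) t₁) (hu _ hD1)
    rw [← this]
    rfl
end
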